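/- In an irreducible root system Φ of finite type with bipartition I = I_+ ∪ I_- of the Coxeter graph vertices, each of the piecewise-linear maps τ_+ and τ_- defined by [τ_ε γ : α_i] = -[γ : α_i] - Σ_{j≠i} a_ij max([γ : α_j], 0) for i ∈ I_ε and [τ_ε γ : α_i] = [γ : α_i] otherwise, is an involution of the root lattice that preserves the set Φ_{≥-1} of almost positive roots. -/

import Mathlib

open Finset

/-- The simple reflection `s_i` acting on the root lattice in the basis of simple
roots: `s_i(γ) = γ - (∑_j a_ij γ_j) α_i`, coming from `s_i(α_j) = α_j - a_ij α_i`. -/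
def cartanRefl {I : Type*} [Fintype I] [DecidableEq I] (A : Matrix I I ℤ) (i : I)
    (γ : I → ℤ) : I → ℤ :=
  fun m => γ m - if m = i then ∑ j, A i j * γ j else 0

/-- The root system `Φ` associated with the Cartan matrix `A`: the orbit of the simple
roots (standard basis vectors) under the group generated by the simple reflections. -/
def rootSet {I : Type*} [Fintype I] [DecidableEq I] (A : Matrix I I ℤ) : Set (I → ℤ) :=
  {γ | ∃ (l : List I) (i : I), γ = l.foldr (fun m δ => cartanRefl A m δ) (Pi.single i 1)}

/-- The piecewise-linear map `τ_ε` : on coordinates `i` with `ε i = s` it acts by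
`[τ_ε γ : α_i] = -[γ : α_i] - ∑_{j ≠ i} a_ij max([γ : α_j], 0)`, and leaves the other
coordinates unchanged. -/
def tauPL {I : Type*} [Fintype I] [DecidableEq I] (A : Matrix I I ℤ) (ε : I → Bool)
    (s : Bool) (γ : I → ℤ) : I → ℤ :=
  fun i => if ε i = s then -γ i - ∑ j ∈ Finset.univ.erase i, A i j * max (γ j) 0
           else γ i

/-- The set `Φ_{≥ -1}` of almost positive roots: positive roots together with the
negatives of the simple roots. -/
def almostPositive {I : Type*} [Fintype I] [DecidableEq I] (A : Matrix I I ℤ) :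
    Set (I → ℤ) :=
  {γ | γ ∈ rootSet A ∧ ∀ i, 0 ≤ γ i} ∪ {γ | ∃ i : I, γ = -Pi.single i 1}

/-- The simple reflection `cartanRefl A i` as a `ℤ`-linear map. -/
def cartanReflLin {I : Type*} [Fintype I] [DecidableEq I] (A : Matrix I I ℤ) (i : I) :
    (I → ℤ) →ₗ[ℤ] (I → ℤ) where
  toFun := cartanRefl A i
  map_add' x y := by
    ext m
    by_cases h : m = i
    · simp [cartanRefl, h, mul_add, Finset.sum_add_distrib]; ring
    · simp [cartanRefl, h]
  map_smul' c x := by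
    ext m
    by_cases h : m = i
    · simp only [cartanRefl, h, Pi.smul_apply, smul_eq_mul, if_true, RingHom.id_apply, mul_sub,
        Finset.mul_sum]
      congr 1
      exact Finset.sum_congr rfl fun j _ => by ring
    · simp [cartanRefl, h]

section Refl

variable {I : Type*} [Fintype I] [DecidableEq I] {A : Matrix I I ℤ}

lemma cartanReflLin_apply (i : I) (x : I → ℤ) : cartanReflLin A i x = cartanRefl A i x := rfl

lemma cartanRefl_eq_sub_smul (i : I) (x : I → ℤ) :
    cartanRefl A i x = x - (∑ j, A i j * x j) • Pi.single i 1 := by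
  ext m
  by_cases h : m = i
  · subst h; simp [cartanRefl]
  · simp [cartanRefl, h]

lemma cartanRefl_of_ne {i m : I} (h : m ≠ i) (x : I → ℤ) : cartanRefl A i x m = x m := by
  simp [cartanRefl, h]

lemma cartanRefl_self (i : I) (x : I → ℤ) :
    cartanRefl A i x i = x i - ∑ j, A i j * x j := by
  simp [cartanRefl]

lemma cartanRefl_single (hdiag : ∀ i, A i i = 2) (i : I) :
    cartanRefl A i (Pi.single i 1) = -Pi.single i 1 := by
  rw [cartanRefl_eq_sub_smul]
  ext m
  simp [Pi.single_apply, hdiag]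
  split_ifs <;> norm_num

lemma cartanRefl_cartanRefl (hdiag : ∀ i, A i i = 2) (i : I) (x : I → ℤ) :
    cartanRefl A i (cartanRefl A i x) = x := by
  rw [← cartanReflLin_apply, cartanRefl_eq_sub_smul i x, map_sub, map_smul, cartanReflLin_apply,
    cartanReflLin_apply, cartanRefl_single hdiag, cartanRefl_eq_sub_smul i x]
  module

lemma single_mem_rootSet (i : I) : Pi.single i 1 ∈ rootSet A := ⟨[], i, rfl⟩

lemma cartanRefl_mem_rootSet (i : I) {γ : I → ℤ} (h : γ ∈ rootSet A) :
    cartanRefl A i γ ∈ rootSet A := by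
  obtain ⟨l, k, rfl⟩ := h
  exact ⟨i :: l, k, rfl⟩

lemma foldr_cartanRefl_mem_rootSet (l : List I) {γ : I → ℤ} (h : γ ∈ rootSet A) :
    l.foldr (fun m δ => cartanRefl A m δ) γ ∈ rootSet A := by
  induction l with
  | nil => exact h
  | cons a l ih => exact cartanRefl_mem_rootSet a ih

lemma rootSet_induction {p : (I → ℤ) → Prop} (hs : ∀ i, p (Pi.single i 1))
    (hr : ∀ i γ, p γ → p (cartanRefl A i γ)) {γ : I → ℤ} (h : γ ∈ rootSet A) : p γ := by
  obtain ⟨l, k, rfl⟩ := h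
  induction l with
  | nil => exact hs k
  | cons a l ih => exact hr a _ ih

lemma list_prod_cartanReflLin_apply (l : List I) (x : I → ℤ) :
    (l.map (cartanReflLin A)).prod x = l.foldr (fun m δ => cartanRefl A m δ) x := by
  induction l with
  | nil => rfl
  | cons a l ih => simp [Module.End.mul_apply, ih, cartanReflLin_apply]

lemma finite_range_prod_cartanReflLin (hfin : (rootSet A).Finite) :
    (Set.range fun l : List I => (l.map (cartanReflLin A)).prod).Finite := by
  refine Set.Finite.of_finite_image (f := fun g (i : I) => g (Pi.single i 1)) ?_ ?_
  · refine (Set.Finite.pi' fun _ : I => hfin).subset ?_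
    rintro _ ⟨_, ⟨l, rfl⟩, rfl⟩ i
    exact ⟨l, i, list_prod_cartanReflLin_apply l _⟩
  · intro f _ g _ h
    refine (Pi.basisFun ℤ I).ext fun i => ?_
    simpa using congrFun h i

/-- Averaging the standard form over the finite Weyl group. -/
lemma exists_invariant_form (hdiag : ∀ i, A i i = 2) (hfin : (rootSet A).Finite) :
    ∃ B : LinearMap.BilinForm ℤ (I → ℤ), (∀ x y, B x y = B y x) ∧ (∀ x, x ≠ 0 → 0 < B x x) ∧
      ∀ i x y, B (cartanRefl A i x) (cartanRefl A i y) = B x y := by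
  have hG := finite_range_prod_cartanReflLin hfin
  have key : ∀ x y, (∑ g ∈ hG.toFinset, (dotProductBilin ℤ ℤ).compl₁₂ g g) x y =
      ∑ g ∈ hG.toFinset, g x ⬝ᵥ g y := by
    intro x y
    simp [LinearMap.sum_apply]
  refine ⟨∑ g ∈ hG.toFinset, (dotProductBilin ℤ ℤ).compl₁₂ g g, ?_, ?_, ?_⟩
  · intro x y
    rw [key, key]
    exact Finset.sum_congr rfl fun g _ => dotProduct_comm _ _
  · intro x hx
    rw [key]
    refine Finset.sum_pos' (fun g _ => Finset.sum_nonneg fun k _ => mul_self_nonneg _)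
      ⟨1, hG.mem_toFinset.2 ⟨[], rfl⟩, ?_⟩
    refine lt_of_le_of_ne (Finset.sum_nonneg fun k _ => mul_self_nonneg _) fun h => hx ?_
    exact dotProduct_self_eq_zero.1 h.symm
  · intro i x y
    rw [key, key]
    have hinv : cartanReflLin A i * cartanReflLin A i = 1 :=
      LinearMap.ext fun z => cartanRefl_cartanRefl hdiag i z
    have hmem : ∀ g ∈ hG.toFinset, g * cartanReflLin A i ∈ hG.toFinset := by
      intro g hg
      obtain ⟨l, rfl⟩ := hG.mem_toFinset.1 hg
      exact hG.mem_toFinset.2 ⟨l ++ [i], by simp⟩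
    exact Finset.sum_nbij' (· * cartanReflLin A i) (· * cartanReflLin A i) hmem hmem
      (fun g _ => by simp [mul_assoc, hinv]) (fun g _ => by simp [mul_assoc, hinv])
      (fun g _ => rfl)

lemma form_eq_sum (B : LinearMap.BilinForm ℤ (I → ℤ)) (x y : I → ℤ) :
    B x y = ∑ i, x i * B (Pi.single i 1) y := by
  have hx : x = ∑ i, x i • Pi.single i 1 := by
    simpa using ((Pi.basisFun ℤ I).sum_repr x).symm
  conv_lhs => rw [hx]
  simp only [map_sum, map_smul, LinearMap.sum_apply, LinearMap.smul_apply, smul_eq_mul]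

section Form

variable {B : LinearMap.BilinForm ℤ (I → ℤ)}

lemma two_mul_form_single (hdiag : ∀ i, A i i = 2)
    (hinv : ∀ i x y, B (cartanRefl A i x) (cartanRefl A i y) = B x y) (i : I) (x : I → ℤ) :
    2 * B (Pi.single i 1) x = (∑ j, A i j * x j) * B (Pi.single i 1) (Pi.single i 1) := by
  have h := hinv i (Pi.single i 1) x
  rw [cartanRefl_single hdiag, cartanRefl_eq_sub_smul] at h
  simp only [map_neg, map_sub, map_smul, LinearMap.neg_apply, smul_eq_mul] at h
  linarith

lemma root_ne_zero (hdiag : ∀ i, A i i = 2) {γ : I → ℤ} (hγ : γ ∈ rootSet A) : γ ≠ 0 := by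
  refine rootSet_induction (p := fun γ => γ ≠ 0) (fun i => by simp) (fun i γ h h0 => h ?_) hγ
  rw [← cartanRefl_cartanRefl hdiag i γ, h0, ← cartanReflLin_apply, map_zero]

/-- The coordinates of a coroot are integers. -/
lemma form_self_dvd (hdiag : ∀ i, A i i = 2) (hsymm : ∀ x y, B x y = B y x)
    (hinv : ∀ i x y, B (cartanRefl A i x) (cartanRefl A i y) = B x y)
    {γ : I → ℤ} (hγ : γ ∈ rootSet A) (i : I) :
    B γ γ ∣ γ i * B (Pi.single i 1) (Pi.single i 1) := by
  revert i
  refine rootSet_induction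
    (p := fun γ => ∀ i, B γ γ ∣ γ i * B (Pi.single i 1) (Pi.single i 1)) ?_ ?_ hγ
  · intro k i
    by_cases h : i = k
    · subst h; simp
    · simp [h]
  · intro k γ h i
    rw [hinv]
    by_cases hik : i = k
    · subst hik
      rw [cartanRefl_self, sub_mul, ← two_mul_form_single hdiag hinv, hsymm (Pi.single i 1) γ]
      refine dvd_sub (h i) ?_
      rw [form_eq_sum B γ (Pi.single i 1), Finset.mul_sum]
      refine Finset.dvd_sum fun j _ => ?_
      rw [mul_left_comm, two_mul_form_single hdiag hinv, mul_left_comm]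
      exact (h j).mul_left _
    · rw [cartanRefl_of_ne hik]
      exact h i

lemma pairing_lt_two_mul_coeff (hdiag : ∀ i, A i i = 2) (hsymm : ∀ x y, B x y = B y x)
    (hpos : ∀ x, x ≠ 0 → 0 < B x x)
    (hinv : ∀ i x y, B (cartanRefl A i x) (cartanRefl A i y) = B x y)
    {γ : I → ℤ} (hγ : γ ∈ rootSet A) {i j : I} (hi : 0 < γ i) (hij : j ≠ i) (hj : γ j ≠ 0) :
    ∑ k, A i k * γ k < 2 * γ i := by
  by_contra! hle
  have hd : 0 < B (Pi.single i 1) (Pi.single i 1) := hpos _ (by simp)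
  have hD : 0 < B γ γ := hpos _ (root_ne_zero hdiag hγ)
  have hDle := Int.le_of_dvd (mul_pos hi hd) (form_self_dvd hdiag hsymm hinv hγ i)
  have h2 := two_mul_form_single hdiag hinv i γ
  set d := B (Pi.single i 1) (Pi.single i 1)
  set D := B γ γ
  set b := B (Pi.single i 1) γ with hb
  have hcb : γ i * d ≤ b := by nlinarith
  have hdb : d ≤ b := by nlinarith
  have hDb : D ≤ b := hDle.trans hcb
  have hb0 : 0 < b := hd.trans_le hdb
  have hne : D • Pi.single i 1 - b • γ ≠ 0 := fun h => by
    have := congrFun h j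
    simp [hij, hb0.ne', hj] at this
  have hcs := hpos _ hne
  simp only [map_sub, map_smul, LinearMap.sub_apply, LinearMap.smul_apply, smul_eq_mul,
    hsymm γ (Pi.single i 1)] at hcs
  have hcs' : 0 < D * (D * d - b * b) := by
    calc 0 < _ := hcs
      _ = _ := by ring
  have := pos_of_mul_pos_right hcs' hD.le
  nlinarith [mul_le_mul hDb hdb hd.le hb0.le]

lemma exists_pos_coeff_pos_pairing (hdiag : ∀ i, A i i = 2) (hoff : ∀ i j, i ≠ j → A i j ≤ 0)
    (hpos : ∀ x, x ≠ 0 → 0 < B x x)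
    (hinv : ∀ i x y, B (cartanRefl A i x) (cartanRefl A i y) = B x y)
    {γ : I → ℤ} {i₀ : I} (h₀ : 0 < γ i₀) : ∃ i, 0 < γ i ∧ 0 < ∑ k, A i k * γ k := by
  set p : I → ℤ := fun i => max (γ i) 0 with hp
  have hp0 : p ≠ 0 := fun h => by
    have := congrFun h i₀
    simp [hp] at this
    omega
  have hB := hpos p hp0
  rw [form_eq_sum] at hB
  obtain ⟨i, -, hi⟩ := Finset.exists_lt_of_sum_lt (s := Finset.univ) (f := fun _ : I => (0 : ℤ))
    (by simpa using hB)
  have hpi : 0 ≤ p i := le_max_right _ _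
  have hBi := pos_of_mul_pos_right hi hpi
  have hpi' : 0 < p i := lt_of_le_of_ne hpi fun h => by simp [← h] at hi
  have hγi : 0 < γ i := by simpa [hp] using hpi'
  refine ⟨i, hγi, ?_⟩
  have h2 := two_mul_form_single hdiag hinv i p
  have hd : 0 < B (Pi.single i 1) (Pi.single i 1) := hpos _ (by simp)
  have hsum : 0 < ∑ j, A i j * p j := pos_of_mul_pos_left (by linarith) hd.le
  refine hsum.trans_le (Finset.sum_le_sum fun j _ => ?_)
  by_cases hij : i = j
  · subst hij
    simp [hp, hγi.le]
  · exact mul_le_mul_of_nonpos_left (le_max_left _ _) (hoff i j hij)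

end Form

/-- A root that has a positive coordinate is positive. -/
lemma root_nonneg_of_coeff_pos (hdiag : ∀ i, A i i = 2) (hoff : ∀ i j, i ≠ j → A i j ≤ 0)
    (hfin : (rootSet A).Finite) {γ : I → ℤ} (hγ : γ ∈ rootSet A) {i₀ : I} (h₀ : 0 < γ i₀) :
    ∀ j, 0 ≤ γ j := by
  obtain ⟨B, hsymm, hpos, hinv⟩ := exists_invariant_form hdiag hfin
  induction hN : ∑ i, (γ i).natAbs using Nat.strong_induction_on generalizing γ i₀ with
  | _ N ih =>
  intro j
  by_contra! hj
  obtain ⟨i, hi, hn⟩ := exists_pos_coeff_pos_pairing hdiag hoff hpos hinv h₀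
  have hji : j ≠ i := by rintro rfl; omega
  have hlt := pairing_lt_two_mul_coeff hdiag hsymm hpos hinv hγ hi hji hj.ne
  by_cases hk : ∃ k, 0 < cartanRefl A i γ k
  · obtain ⟨k, hk⟩ := hk
    have hsmall : ∑ m, (cartanRefl A i γ m).natAbs < N := by
      rw [← hN]
      refine Finset.sum_lt_sum (fun m _ => ?_) ⟨i, Finset.mem_univ _, ?_⟩
      · by_cases hm : m = i
        · subst hm; rw [cartanRefl_self]; omega
        · rw [cartanRefl_of_ne hm]
      · rw [cartanRefl_self]; omega
    have := ih _ hsmall (cartanRefl_mem_rootSet i hγ) hk rfl j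
    rw [cartanRefl_of_ne hji] at this
    omega
  · push Not at hk
    refine hlt.not_ge ?_
    rw [← Finset.add_sum_erase _ _ (Finset.mem_univ i), hdiag]
    refine le_add_of_nonneg_right (Finset.sum_nonneg fun k hk' => ?_)
    have hki := Finset.ne_of_mem_erase hk'
    have := hk k
    rw [cartanRefl_of_ne hki] at this
    exact mul_nonneg_of_nonpos_of_nonpos (hoff i k hki.symm) this

/-- A root `γ` that pairs with `αᵢ` as `γ i • αᵢ` does, where `γ i > 0`, is `αᵢ`. -/
lemma root_eq_single (hdiag : ∀ i, A i i = 2) (hfin : (rootSet A).Finite) {γ : I → ℤ}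
    (hγ : γ ∈ rootSet A) {i : I} (hi : 0 < γ i) (hsum : ∑ k, A i k * γ k = 2 * γ i) :
    γ = Pi.single i 1 := by
  obtain ⟨B, hsymm, hpos, hinv⟩ := exists_invariant_form hdiag hfin
  have hz : ∀ j, j ≠ i → γ j = 0 := fun j hj => by
    by_contra h
    exact (pairing_lt_two_mul_coeff hdiag hsymm hpos hinv hγ hi hj h).ne hsum
  have hγi : γ = γ i • Pi.single i 1 := by
    ext m
    by_cases hm : m = i
    · subst hm; simp
    · simp [hm, hz m hm]
  have hd : 0 < B (Pi.single i 1) (Pi.single i 1) := hpos _ (by simp)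
  have hle := Int.le_of_dvd (mul_pos hi hd) (form_self_dvd hdiag hsymm hinv hγ i)
  have hB : B γ γ = γ i * (γ i * B (Pi.single i 1) (Pi.single i 1)) := by
    conv_lhs => rw [hγi]
    simp only [map_smul, LinearMap.smul_apply, smul_eq_mul]
  rw [hB] at hle
  have h1 : γ i = 1 := by nlinarith [mul_pos hi hd]
  rw [hγi, h1, one_smul]

end Refl

section Tau

variable {I : Type*} [Fintype I] [DecidableEq I] {A : Matrix I I ℤ} {ε : I → Bool} {s : Bool}

lemma tauPL_of_ne {i : I} (h : ε i ≠ s) (γ : I → ℤ) : tauPL A ε s γ i = γ i := by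
  simp [tauPL, h]

lemma tauPL_tauPL (hbip : ∀ i j, i ≠ j → A i j ≠ 0 → ε i ≠ ε j) (γ : I → ℤ) :
    tauPL A ε s (tauPL A ε s γ) = γ := by
  ext i
  by_cases h : ε i = s
  · have hsum : ∑ j ∈ Finset.univ.erase i, A i j * max (tauPL A ε s γ j) 0 =
        ∑ j ∈ Finset.univ.erase i, A i j * max (γ j) 0 := by
      refine Finset.sum_congr rfl fun j hj => ?_
      by_cases hA : A i j = 0
      · simp [hA]
      · rw [tauPL_of_ne fun hs => hbip i j (Finset.ne_of_mem_erase hj).symm hA (h.trans hs.symm)]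
    rw [tauPL, if_pos h, hsum, tauPL, if_pos h]
    ring
  · rw [tauPL_of_ne h, tauPL_of_ne h]

lemma foldr_cartanRefl_apply (hbip : ∀ i j, i ≠ j → A i j ≠ 0 → ε i ≠ ε j) (γ : I → ℤ)
    {l : List I} (hl : ∀ i ∈ l, ε i = s) (hnd : l.Nodup) (m : I) :
    l.foldr (fun m δ => cartanRefl A m δ) γ m =
      if m ∈ l then γ m - ∑ j, A m j * γ j else γ m := by
  induction l generalizing m with
  | nil => simp
  | cons a l ih =>
    have ih' := ih (fun i hi => hl i (List.mem_cons_of_mem _ hi)) (List.nodup_cons.1 hnd).2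
    have ha := (List.nodup_cons.1 hnd).1
    rw [List.foldr_cons]
    by_cases hm : m = a
    · subst hm
      rw [cartanRefl_self, ih', if_neg ha, if_pos List.mem_cons_self]
      congr 1
      refine Finset.sum_congr rfl fun j _ => ?_
      by_cases hA : A m j = 0
      · simp [hA]
      · rw [ih', if_neg]
        intro hj
        have hmj : m ≠ j := by rintro rfl; exact ha hj
        exact hbip m j hmj hA
          ((hl m List.mem_cons_self).trans (hl j (List.mem_cons_of_mem _ hj)).symm)
    · rw [cartanRefl_of_ne hm, ih']
      simp [hm]

/-- On nonnegative vectors `τ_s` is the product of the commuting reflections with sign `s`. -/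
lemma tauPL_mem_rootSet (hdiag : ∀ i, A i i = 2)
    (hbip : ∀ i j, i ≠ j → A i j ≠ 0 → ε i ≠ ε j) {γ : I → ℤ} (hγ : γ ∈ rootSet A)
    (h0 : ∀ i, 0 ≤ γ i) : tauPL A ε s γ ∈ rootSet A := by
  have : tauPL A ε s γ =
      (Finset.univ.filter (ε · = s)).toList.foldr (fun m δ => cartanRefl A m δ) γ := by
    ext m
    rw [foldr_cartanRefl_apply (s := s) hbip γ (by simp) (Finset.nodup_toList _)]
    by_cases h : ε m = s
    · rw [if_pos (by simpa using h), tauPL, if_pos h,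
        ← Finset.add_sum_erase _ (fun j => A m j * γ j) (Finset.mem_univ m), hdiag]
      simp only [max_eq_left (h0 _)]
      ring
    · rw [if_neg (by simpa using h), tauPL_of_ne h]
  rw [this]
  exact foldr_cartanRefl_mem_rootSet _ hγ

lemma tauPL_single (hbip : ∀ i j, i ≠ j → A i j ≠ 0 → ε i ≠ ε j) {i : I} (hi : ε i = s) :
    tauPL A ε s (Pi.single i 1) = -Pi.single i 1 := by
  ext m
  by_cases h : ε m = s
  · rw [tauPL, if_pos h, Finset.sum_eq_zero]
    · simp
    · intro j hj
      by_cases hA : A m j = 0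
      · simp [hA]
      · have : j ≠ i := by
          rintro rfl
          exact hbip m j (Finset.ne_of_mem_erase hj).symm hA (h.trans hi.symm)
        simp [this]
  · have : m ≠ i := by rintro rfl; exact h hi
    simp [tauPL_of_ne h, this]

lemma tauPL_neg_single (i : I) :
    tauPL A ε s (-Pi.single i 1) = if ε i = s then Pi.single i 1 else -Pi.single i 1 := by
  have hmax : ∀ j, max ((-Pi.single i 1 : I → ℤ) j) 0 = 0 := fun j => by
    by_cases h : j = i
    · subst h; simp
    · simp [h]
  ext m
  by_cases hm : m = i
  · subst hm
    simp only [tauPL, hmax]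
    split_ifs <;> simp
  · simp only [tauPL, hmax]
    split_ifs <;> simp [hm]

lemma tauPL_mem_almostPositive (hdiag : ∀ i, A i i = 2) (hoff : ∀ i j, i ≠ j → A i j ≤ 0)
    (hbip : ∀ i j, i ≠ j → A i j ≠ 0 → ε i ≠ ε j) (hfin : (rootSet A).Finite) {γ : I → ℤ}
    (hγ : γ ∈ almostPositive A) : tauPL A ε s γ ∈ almostPositive A := by
  rcases hγ with ⟨hγ, h0⟩ | ⟨i, rfl⟩
  · have hτ := tauPL_mem_rootSet (s := s) hdiag hbip hγ h0
    by_cases hj : ∃ j, ε j ≠ s ∧ γ j ≠ 0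
    · obtain ⟨j, hjs, hj⟩ := hj
      refine Or.inl ⟨hτ, root_nonneg_of_coeff_pos hdiag hoff hfin hτ (i₀ := j) ?_⟩
      rw [tauPL_of_ne hjs]
      exact lt_of_le_of_ne (h0 j) hj.symm
    · push Not at hj
      obtain ⟨i, hi⟩ := Function.ne_iff.1 (root_ne_zero hdiag hγ)
      have his : ε i = s := by
        by_contra h
        exact hi (hj i h)
      have hγi : γ = Pi.single i 1 := by
        refine root_eq_single hdiag hfin hγ (lt_of_le_of_ne (h0 i) (Ne.symm hi)) ?_
        rw [Finset.sum_eq_single i, hdiag]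
        · intro j _ hji
          by_cases hA : A i j = 0
          · simp [hA]
          · rw [hj j fun h => hbip i j hji.symm hA (his.trans h.symm), mul_zero]
        · simp
      exact Or.inr ⟨i, hγi ▸ tauPL_single hbip his⟩
  · rw [tauPL_neg_single]
    split_ifs
    · exact Or.inl ⟨single_mem_rootSet i, fun j => by
        by_cases h : j = i
        · subst h; simp
        · simp [h]⟩
    · exact Or.inr ⟨i, rfl⟩

end Tau

/-- For an irreducible root system of finite type with bipartite Coxeter graph
`I = I₊ ∪ I₋` (recorded by the sign function `ε`), each of the piecewise-linear maps
`τ₊`, `τ₋` is an involution of the root lattice preserving the set `Φ_{≥ -1}` of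
almost positive roots. -/
theorem tau_involution_preserves_almostPositive {I : Type*} [Fintype I] [DecidableEq I]
    (A : Matrix I I ℤ) (ε : I → Bool)
    (hdiag : ∀ i, A i i = 2)
    (hoff : ∀ i j, i ≠ j → A i j ≤ 0)
    (hzero : ∀ i j, A i j = 0 ↔ A j i = 0)
    (hbip : ∀ i j, i ≠ j → A i j ≠ 0 → ε i ≠ ε j)
    (hirr : ∀ s : Set I, (∀ i ∈ s, ∀ j ∉ s, A i j = 0) → s = ∅ ∨ s = Set.univ)
    (hfin : (rootSet A).Finite) :
    ∀ s : Bool,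
      (∀ γ : I → ℤ, tauPL A ε s (tauPL A ε s γ) = γ) ∧
      tauPL A ε s '' almostPositive A = almostPositive A := by
  intro s
  refine ⟨tauPL_tauPL hbip, Set.Subset.antisymm ?_ fun γ hγ => ?_⟩
  · rintro _ ⟨γ, hγ, rfl⟩
    exact tauPL_mem_almostPositive hdiag hoff hbip hfin hγ
  · exact ⟨_, tauPL_mem_almostPositive hdiag hoff hbip hfin hγ, tauPL_tauPL hbip γ⟩
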